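/- Let A = (Q, A, ·, ∘) be a reversible invertible Mealy automaton such that G = 𝒢(A) is infinite. If the stabilizer in G of every infinite word u ∈ A^ω is trivial, then G is a Burnside group: every element of G has finite order. -/

import Mathlib

/-- A Mealy automaton (transducer) with state set `Q` and alphabet `A`. -/
structure Mealy (Q A : Type*) where
  step : Q → A → Q
  out : Q → A → A

namespace Mealy

variable {Q A : Type*}

/-- Action of a state on finite words over the alphabet. -/
def act (M : Mealy Q A) : Q → List A → List A
  | _, [] => []
  | q, a :: w => M.out q a :: act M (M.step q a) w

/-- Action of the formal inverse of a state on finite words. -/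
noncomputable def actInv (M : Mealy Q A) [Nonempty A] : Q → List A → List A
  | _, [] => []
  | q, a :: w =>
    Function.invFun (M.out q) a ::
      actInv M (M.step q (Function.invFun (M.out q) a)) w

/-- Action of a word over `Q ∪ Q⁻¹` (letters `(q, true)` are positive, `(q, false)`
are formal inverses) on finite words over the alphabet. -/
noncomputable def evalW (M : Mealy Q A) [Nonempty A] : List (Q × Bool) → List A → List A
  | [], v => v
  | (q, true) :: w, v => act M q (evalW M w v)
  | (q, false) :: w, v => actInv M q (evalW M w v)

/-- Invertibility: every output function is a permutation of the alphabet. -/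
def IsInvertible (M : Mealy Q A) : Prop := ∀ q, Function.Bijective (M.out q)

/-- Reversibility: every letter acts as a permutation of the states. -/
def IsReversible (M : Mealy Q A) : Prop := ∀ a, Function.Bijective fun q => M.step q a

/-- Bireversibility: invertible, reversible, and the output automaton is reversible. -/
def IsBireversible (M : Mealy Q A) [Nonempty A] : Prop :=
  M.IsInvertible ∧ M.IsReversible ∧
    ∀ b, Function.Bijective fun q => M.step q (Function.invFun (M.out q) b)

/-- The dual automaton: states and letters are exchanged. -/
def dual (M : Mealy Q A) : Mealy A Q where
  step a q := M.out q a
  out a q := M.step q a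

/-- The enriched dual `(∂A)⁻ = ∂(A ⊔ A⁻¹)`: states are letters of `A`,
the alphabet is `Q ∪ Q⁻¹`. -/
noncomputable def edual (M : Mealy Q A) [Nonempty A] : Mealy A (Q × Bool) where
  step a qs :=
    match qs with
    | (q, true) => M.out q a
    | (q, false) => Function.invFun (M.out q) a
  out a qs :=
    match qs with
    | (q, true) => (M.step q a, true)
    | (q, false) => (M.step q (Function.invFun (M.out q) a), false)

/-- The disjoint union `A ⊔ A⁻¹` of an invertible automaton with its inverse:
states are `Q ∪ Q⁻¹`. -/
noncomputable def withInv (M : Mealy Q A) [Nonempty A] : Mealy (Q × Bool) A where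
  step qs a :=
    match qs with
    | (q, true) => (M.step q a, true)
    | (q, false) => (M.step q (Function.invFun (M.out q) a), false)
  out qs a :=
    match qs with
    | (q, true) => M.out q a
    | (q, false) => Function.invFun (M.out q) a

/-- The enrichment `A⁻` of a reversible transducer, over the doubled alphabet
`A ∪ A⁻¹`: to every transition `q →^{a|b} p` the inverse transition
`p →^{a⁻¹|b⁻¹} q` is added. -/
noncomputable def enrich (M : Mealy Q A) [Nonempty Q] : Mealy Q (A × Bool) where
  step q as :=
    match as with
    | (a, true) => M.step q a
    | (a, false) => Function.invFun (fun p => M.step p a) q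
  out q as :=
    match as with
    | (a, true) => (M.out q a, true)
    | (a, false) => (M.out (Function.invFun (fun p => M.step p a) q) a, false)

/-- The state reached from `q` after reading the word `w`. -/
def run (M : Mealy Q A) (q : Q) (w : List A) : Q := w.foldl M.step q

/-- Action of a state on right-infinite words over the alphabet. -/
def actOmega (M : Mealy Q A) (q : Q) (u : ℕ → A) : ℕ → A :=
  fun n => M.out (M.run q (List.ofFn fun i : Fin n => u i)) (u n)

/-- Action of a word of states on right-infinite words. -/
def applyListOmega (M : Mealy Q A) (l : List Q) (u : ℕ → A) : ℕ → A :=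
  l.foldl (fun v q => M.actOmega q v) u

/-- The orbit of a boundary point under the semigroup generated by the states. -/
def orbitOmega (M : Mealy Q A) (u : ℕ → A) : Set (ℕ → A) :=
  {z | ∃ l : List Q, z = M.applyListOmega l u}

/-- Action of a word of states on finite words over the alphabet. -/
def wact (M : Mealy Q A) : List Q → List A → List A
  | [], u => u
  | q :: w, u => act M q (wact M w u)

/-- State-word transition: the coupled action `w · u` of an input word `u` on a
word of states `w`. -/
def wstep (M : Mealy Q A) : List Q → List A → List Q
  | [], _ => []
  | q :: w, u => M.run q (wact M w u) :: wstep M w u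

end Mealy

/-- The length-`n` prefix of a right-infinite word. -/
def pre {α : Type*} (u : ℕ → α) (n : ℕ) : List α := List.ofFn fun i : Fin n => u i

/-- The periodic infinite word `w^ω`. -/
def periodicWord {α : Type*} [Inhabited α] (w : List α) : ℕ → α :=
  fun n => w.getD (n % w.length) default

/-- The generating permutations of the automaton group: permutations of `A*` that
agree with the action of some state. -/
def Mealy.genSet {Q A : Type*} (M : Mealy Q A) : Set (Equiv.Perm (List A)) :=
  {σ | ∃ q : Q, ∀ w, σ w = M.act q w}

/-- The group `𝒢(A)` generated by an invertible Mealy automaton, as a group of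
permutations of the tree `A*`. -/
def Mealy.autGroup {Q A : Type*} (M : Mealy Q A) : Subgroup (Equiv.Perm (List A)) :=
  Subgroup.closure M.genSet

/-- `𝒢(A)` has all trivial stabilizers in the boundary `A^ω`: the only element of
the group fixing every finite prefix of some infinite word is the identity. -/
def Mealy.AllTrivialBoundaryStabilizers {Q A : Type*} (M : Mealy Q A) : Prop :=
  ∀ u : ℕ → A, ∀ g ∈ M.autGroup,
    (∀ n : ℕ, g (pre u n) = pre u n) → g = 1


/-! ### A permutation-group lemma (discrete version of tidiness above) -/

theorem tidy_aux {X : Type*} (K : Subgroup (Equiv.Perm X)) (t : Equiv.Perm X) (ht : t ∈ K)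
    (x : X) (hfin : ∀ y : X, {z | ∃ f ∈ K, f x = x ∧ z = f y}.Finite) :
    ∃ n : ℕ, ∀ y ∈ K, (∀ i : ℕ, i ≤ n → y ((t ^ i) x) = (t ^ i) x) →
      ∀ j : ℕ, ((t * y) ^ j) x = x → (t ^ j) x = x := by
  let O : ℕ → Set X := fun n =>
    {z | ∃ f ∈ K, (∀ i : ℕ, i ≤ n → f ((t ^ i) x) = (t ^ i) x) ∧ z = f ((t ^ (n + 1)) x)}
  let O' : ℕ → Set X := fun n =>
    {z | ∃ f ∈ K, f (t⁻¹ x) = t⁻¹ x ∧ (∀ i : ℕ, i ≤ n → f ((t ^ i) x) = (t ^ i) x) ∧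
      z = f ((t ^ (n + 1)) x)}
  have hOfin : ∀ n, (O n).Finite := fun n => (hfin ((t ^ (n + 1)) x)).subset (by
    rintro z ⟨f, hf, hfix, rfl⟩
    exact ⟨f, hf, by simpa using hfix 0 (Nat.zero_le _), rfl⟩)
  have hO' : ∀ n, O' n ⊆ O n := by
    rintro n z ⟨f, hf, -, hfix, rfl⟩
    exact ⟨f, hf, hfix, rfl⟩
  have hts : ∀ (i : ℕ), t ((t ^ i) x) = (t ^ (i + 1)) x := by
    intro i; rw [pow_succ', Equiv.Perm.mul_apply]
  have hts' : ∀ (i : ℕ), t⁻¹ ((t ^ (i + 1)) x) = (t ^ i) x := by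
    intro i; rw [← hts]; simp
  have hsub : ∀ n, O (n + 1) ⊆ t '' (O' n) := by
    rintro n z ⟨f, hf, hfix, rfl⟩
    refine ⟨t⁻¹ (f ((t ^ (n + 1 + 1)) x)), ⟨t⁻¹ * f * t, ?_, ?_, ?_, ?_⟩, by simp⟩
    · exact K.mul_mem (K.mul_mem (K.inv_mem ht) hf) ht
    · have := hfix 0 (Nat.zero_le _)
      simp only [pow_zero, Equiv.Perm.one_apply] at this
      simp [Equiv.Perm.mul_apply, this]
    · intro i hi
      simp only [Equiv.Perm.mul_apply]
      rw [hts, hfix (i + 1) (by omega), hts']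
    · simp only [Equiv.Perm.mul_apply]
      rw [hts]
  have hc1 : ∀ n, (O (n + 1)).ncard ≤ (O' n).ncard := fun n => by
    have hf := (hOfin n).subset (hO' n)
    exact (Set.ncard_le_ncard (hsub n) (hf.image _)).trans (Set.ncard_image_le hf)
  have hc2 : ∀ n, (O' n).ncard ≤ (O n).ncard := fun n => Set.ncard_le_ncard (hO' n) (hOfin n)
  have hanti : Antitone fun n => (O n).ncard := antitone_nat_of_succ_le fun n =>
    (hc1 n).trans (hc2 n)
  obtain ⟨n0, hn0⟩ : ∃ n0, ∀ n, n0 ≤ n → (O n).ncard = (O n0).ncard := by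
    obtain ⟨n0, hn0⟩ := WellFounded.has_min (wellFounded_lt (α := ℕ))
      (Set.range fun n => (O n).ncard) ⟨_, 0, rfl⟩ |>.imp fun m h => h
    obtain ⟨⟨k, rfl⟩, hk⟩ := hn0
    exact ⟨k, fun n hn => le_antisymm (hanti hn) (not_lt.1 (hk _ ⟨n, rfl⟩))⟩
  have heq : ∀ n, n0 ≤ n → O n ⊆ O' n := fun n hn => by
    refine (Set.eq_of_subset_of_ncard_le (hO' n) ?_ (hOfin n)).ge
    calc (O n).ncard = (O (n + 1)).ncard := by rw [hn0 n hn, hn0 (n + 1) (by omega)]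
      _ ≤ _ := hc1 n
  -- decomposition
  have hdec : ∀ y ∈ K, (∀ i : ℕ, i ≤ n0 → y ((t ^ i) x) = (t ^ i) x) → ∀ k : ℕ,
      ∃ z ∈ K, z (t⁻¹ x) = t⁻¹ x ∧ (∀ i : ℕ, i ≤ n0 → z ((t ^ i) x) = (t ^ i) x) ∧
        ∀ i : ℕ, i ≤ n0 + k → z ((t ^ i) x) = y ((t ^ i) x) := by
    intro y hy hyf k
    induction k with
    | zero => exact ⟨1, K.one_mem, rfl, fun _ _ => rfl, fun i hi => (hyf i (by omega)).symm⟩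
    | succ k ih =>
      obtain ⟨z, hz, hz1, hz2, hz3⟩ := ih
      obtain ⟨z', hz', h1, h2, h3⟩ := heq (n0 + k) (by omega)
        (⟨z⁻¹ * y, K.mul_mem (K.inv_mem hz) hy, fun i hi => by
          rw [Equiv.Perm.mul_apply, ← hz3 i hi]; simp, rfl⟩ :
          (z⁻¹ * y) ((t ^ (n0 + k + 1)) x) ∈ O (n0 + k))
      refine ⟨z * z', K.mul_mem hz hz', ?_, ?_, ?_⟩
      · rw [Equiv.Perm.mul_apply, h1, hz1]
      · intro i hi
        rw [Equiv.Perm.mul_apply, h2 i (by omega), hz2 i hi]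
      · intro i hi
        rw [Equiv.Perm.mul_apply]
        rcases Nat.lt_or_ge (n0 + k) i with h | h
        · obtain rfl : i = n0 + k + 1 := by omega
          rw [← h3]; simp
        · rw [h2 i h, hz3 i h]
  refine ⟨n0, fun y hy hyf => ?_⟩
  have key : ∀ j : ℕ, ∃ v ∈ K, (∀ i : ℕ, i ≤ n0 → v ((t ^ i) x) = (t ^ i) x) ∧
      ((t * y) ^ j) x = v ((t ^ j) x) := by
    intro j
    induction j with
    | zero => exact ⟨1, K.one_mem, fun _ _ => rfl, rfl⟩
    | succ j ih =>
      obtain ⟨v, hv, hvf, hvj⟩ := ih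
      obtain ⟨h, hh, hh1, hh2, hh3⟩ := hdec (y * v) (K.mul_mem hy hv) (fun i hi => by
        rw [Equiv.Perm.mul_apply, hvf i hi, hyf i hi]) j
      refine ⟨t * h * t⁻¹, K.mul_mem (K.mul_mem ht hh) (K.inv_mem ht), ?_, ?_⟩
      · intro i hi
        rcases i with _ | i
        · simp only [pow_zero, Equiv.Perm.mul_apply, Equiv.Perm.one_apply]
          rw [hh1]; simp
        · simp only [Equiv.Perm.mul_apply]
          rw [hts', hh2 i (by omega), hts]
      · rw [pow_succ', Equiv.Perm.mul_apply, hvj]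
        simp only [Equiv.Perm.mul_apply]
        rw [hts', hh3 j (by omega), Equiv.Perm.mul_apply]
  intro j hj
  obtain ⟨v, -, hvf, hvj⟩ := key j
  have h0 := hvf 0 (Nat.zero_le _)
  simp only [pow_zero, Equiv.Perm.one_apply] at h0
  apply v.injective
  rw [← hvj, hj, h0]


/-! ### Basic facts on the action -/

namespace MealyAux

open Mealy

variable {Q A : Type}

theorem act_length (M : Mealy Q A) (w : List A) : ∀ q, (M.act q w).length = w.length := by
  induction w with
  | nil => intro q; rfl
  | cons a w ih => intro q; simp [act, ih]

theorem act_append (M : Mealy Q A) (v w : List A) :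
    ∀ q, M.act q (v ++ w) = M.act q v ++ M.act (M.run q v) w := by
  induction v with
  | nil => intro q; rfl
  | cons a v ih => intro q; simp [act, ih, run]

theorem act_bij (M : Mealy Q A) (hinv : M.IsInvertible) (q : Q) :
    Function.Bijective (M.act q) := by
  constructor
  · intro v
    induction v generalizing q with
    | nil =>
      intro w h
      cases w with
      | nil => rfl
      | cons b w => simp [act] at h
    | cons a v ih =>
      intro w h
      cases w with
      | nil => simp [act] at h
      | cons b w =>
        simp only [act, List.cons.injEq] at h
        obtain ⟨h1, h2⟩ := h
        obtain rfl := (hinv q).1 h1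
        rw [ih _ h2]
  · intro w
    induction w generalizing q with
    | nil => exact ⟨[], rfl⟩
    | cons b w ih =>
      obtain ⟨a, rfl⟩ := (hinv q).2 b
      obtain ⟨v, rfl⟩ := ih (M.step q a)
      exact ⟨a :: v, rfl⟩

/-- The generator attached to a state. -/
noncomputable def gen (M : Mealy Q A) (hinv : M.IsInvertible) (q : Q) : M.autGroup :=
  ⟨Equiv.ofBijective _ (act_bij M hinv q), Subgroup.subset_closure ⟨q, fun _ => rfl⟩⟩

theorem gen_apply (M : Mealy Q A) (hinv : M.IsInvertible) (q : Q) (w : List A) :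
    (gen M hinv q).1 w = M.act q w := rfl

theorem exists_section (M : Mealy Q A) (hinv : M.IsInvertible) (g : Equiv.Perm (List A))
    (hg : g ∈ M.autGroup) :
    (∀ v, (g v).length = v.length) ∧
      ∀ v, ∃ h : M.autGroup, ∀ w, g (v ++ w) = g v ++ h.1 w := by
  induction hg using Subgroup.closure_induction with
  | mem σ hσ =>
    obtain ⟨q, hq⟩ := hσ
    refine ⟨fun v => by rw [hq, act_length], fun v => ⟨gen M hinv (M.run q v), fun w => ?_⟩⟩
    rw [hq, hq, act_append, gen_apply]
  | one => exact ⟨fun _ => rfl, fun v => ⟨1, fun w => rfl⟩⟩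
  | mul g h _ _ ihg ihh =>
    refine ⟨fun v => by rw [Equiv.Perm.mul_apply, ihg.1, ihh.1], fun v => ?_⟩
    obtain ⟨h', hh'⟩ := ihh.2 v
    obtain ⟨g', hg'⟩ := ihg.2 (h v)
    exact ⟨g' * h', fun w => by simp [Equiv.Perm.mul_apply, hh', hg']⟩
  | inv g _ ih =>
    have hl : ∀ v, (g⁻¹ v).length = v.length := fun v => by
      rw [← ih.1 (g⁻¹ v)]; simp
    refine ⟨hl, fun v => ?_⟩
    obtain ⟨h, hh⟩ := ih.2 (g⁻¹ v)
    refine ⟨h⁻¹, fun w => ?_⟩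
    apply g.injective
    rw [hh]
    simp

/-- The section of a group element at a word. -/
noncomputable def sec (M : Mealy Q A) (hinv : M.IsInvertible) (v : List A) (g : M.autGroup) :
    M.autGroup :=
  Classical.choose ((exists_section M hinv g.1 g.2).2 v)

section

variable (M : Mealy Q A) (hinv : M.IsInvertible)

theorem sec_spec (v w : List A) (g : M.autGroup) :
    g.1 (v ++ w) = g.1 v ++ (sec M hinv v g).1 w :=
  Classical.choose_spec ((exists_section M hinv g.1 g.2).2 v) w

theorem g_length (hinv : M.IsInvertible) (v : List A) (g : M.autGroup) : (g.1 v).length = v.length :=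
  (exists_section M hinv g.1 g.2).1 v

theorem sec_unique (v : List A) (g h : M.autGroup) (hh : ∀ w, g.1 (v ++ w) = g.1 v ++ h.1 w) :
    sec M hinv v g = h := by
  apply Subtype.ext
  ext1 w
  have := hh w
  rw [sec_spec M hinv] at this
  exact List.append_cancel_left this

theorem sec_one (v : List A) : sec M hinv v 1 = 1 := sec_unique M hinv _ _ _ fun _ => rfl

theorem sec_nil (g : M.autGroup) : sec M hinv [] g = g := by
  apply sec_unique
  intro w
  have : g.1 [] = [] := List.eq_nil_of_length_eq_zero (by rw [g_length M hinv]; rfl)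
  rw [this]; rfl

theorem sec_mul (v : List A) (g h : M.autGroup) :
    sec M hinv v (g * h) = sec M hinv (h.1 v) g * sec M hinv v h := by
  apply sec_unique
  intro w
  simp only [Subgroup.coe_mul, Equiv.Perm.mul_apply]
  rw [sec_spec M hinv, sec_spec M hinv]

theorem sec_append (v v' : List A) (g : M.autGroup) :
    sec M hinv (v ++ v') g = sec M hinv v' (sec M hinv v g) := by
  apply sec_unique
  intro w
  rw [List.append_assoc, sec_spec M hinv, sec_spec M hinv v v', sec_spec M hinv v', List.append_assoc]

theorem sec_gen (v : List A) (q : Q) :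
    sec M hinv v (gen M hinv q) = gen M hinv (M.run q v) := by
  apply sec_unique
  intro w
  simp only [gen_apply, act_append]

/-- Group element represented by a positive word. -/
noncomputable def ev (w : List Q) : M.autGroup := (w.map (gen M hinv)).prod

theorem ev_nil : ev M hinv [] = 1 := rfl

theorem ev_cons (q : Q) (w : List Q) : ev M hinv (q :: w) = gen M hinv q * ev M hinv w := by
  simp [ev]

theorem ev_append (v w : List Q) : ev M hinv (v ++ w) = ev M hinv v * ev M hinv w := by
  simp [ev]

theorem ev_apply (w : List Q) (u : List A) : (ev M hinv w).1 u = M.wact w u := by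
  induction w with
  | nil => rfl
  | cons q w ih =>
    rw [ev_cons, Subgroup.coe_mul, Equiv.Perm.mul_apply, ih, gen_apply]; rfl

theorem sec_ev (v : List A) (w : List Q) :
    sec M hinv v (ev M hinv w) = ev M hinv (M.wstep w v) := by
  induction w with
  | nil => exact sec_one M hinv v
  | cons q w ih =>
    rw [ev_cons, sec_mul, ih, sec_gen, ev_apply]
    simp only [wstep, ev_cons]

theorem wstep_length (w : List Q) (v : List A) : (M.wstep w v).length = w.length := by
  induction w with
  | nil => rfl
  | cons q w ih => simp [wstep, ih]

theorem run_inj (hrev : M.IsReversible) (v : List A) :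
    Function.Injective fun q => M.run q v := by
  induction v with
  | nil => intro q q' h; exact h
  | cons a v ih =>
    intro q q' h
    exact (hrev a).1 (ih h)

theorem wstep_inj (hrev : M.IsReversible) (v : List A) :
    Function.Injective fun w => M.wstep w v := by
  intro w
  induction w with
  | nil =>
    intro w' h
    cases w' with
    | nil => rfl
    | cons q w' => simp [wstep] at h
  | cons p w ih =>
    intro w' h
    cases w' with
    | nil => simp [wstep] at h
    | cons q w' =>
      simp only [wstep, List.cons.injEq] at h
      obtain ⟨h1, h2⟩ := h
      obtain rfl := ih h2
      rw [run_inj M hrev _ h1]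

theorem wstep_concat (w : List Q) (q : Q) (v : List A) :
    ∃ w', M.wstep (w ++ [q]) v = w' ++ [M.run q v] := by
  induction w with
  | nil => exact ⟨[], rfl⟩
  | cons p w ih =>
    obtain ⟨w', hw'⟩ := ih
    exact ⟨M.run p (wact M (w ++ [q]) v) :: w', by simp [wstep, hw']⟩

theorem sec_ev_iterate (v : List A) (w : List Q) (e : ℕ) :
    (sec M hinv v)^[e] (ev M hinv w) = ev M hinv ((fun w => M.wstep w v)^[e] w) := by
  induction e with
  | zero => rfl
  | succ e ih => rw [Function.iterate_succ_apply', ih, Function.iterate_succ_apply', sec_ev]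

/-- Every word is periodic under the dual action. -/
theorem wstep_periodic [Finite Q] (hrev : M.IsReversible) (v : List A) (w : List Q) :
    ∃ e : ℕ, (fun w => M.wstep w v)^[e + 1] w = w := by
  let T : {l : List Q // l.length = w.length} → {l : List Q // l.length = w.length} :=
    fun l => ⟨M.wstep l.1 v, by rw [wstep_length, l.2]⟩
  have hT : Function.Injective T := fun l l' h =>
    Subtype.ext (wstep_inj M hrev v (congrArg Subtype.val h))
  have : Finite {l : List Q // l.length = w.length} := List.finite_length_eq Q w.length
  obtain ⟨n, hn, hper⟩ := hT.mem_periodicPts ⟨w, rfl⟩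
  have : ∀ (k : ℕ) (l), (T^[k] l).1 = (fun w => M.wstep w v)^[k] l.1 := by
    intro k
    induction k with
    | zero => intro l; rfl
    | succ k ih => intro l; rw [Function.iterate_succ_apply', Function.iterate_succ_apply', ← ih]
  refine ⟨n - 1, ?_⟩
  rw [Nat.sub_add_cancel hn]
  have h2 := this n ⟨w, rfl⟩
  rw [hper] at h2
  exact h2.symm

theorem sec_iterate_one (v : List A) (e : ℕ) : (sec M hinv v)^[e] 1 = 1 := by
  induction e with
  | zero => rfl
  | succ e ih => rw [Function.iterate_succ_apply', ih, sec_one]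

/-- A positive word with a trivial section is trivial. -/
theorem ev_eq_one_of_sec [Finite Q] (hrev : M.IsReversible) (v : List A) (w : List Q)
    (h : sec M hinv v (ev M hinv w) = 1) : ev M hinv w = 1 := by
  obtain ⟨e, he⟩ := wstep_periodic M hrev v w
  have := sec_ev_iterate M hinv v w (e + 1)
  rw [he, Function.iterate_succ_apply, h, sec_iterate_one] at this
  exact this.symm

/-! ### The helix argument -/

/-- Trivial stabilizers, for chains of words. -/
theorem eq_one_of_chain (hinv : M.IsInvertible) (hstab : M.AllTrivialBoundaryStabilizers) (k : M.autGroup)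
    (Z : ℕ → List A) (hpre : ∀ n, Z n <+: Z (n + 1)) (hlen : ∀ n, n ≤ (Z n).length)
    (hfix : ∀ n, k.1 (Z n) = Z n) : k = 1 := by
  have hmono : ∀ i j, i ≤ j → Z i <+: Z j := by
    intro i j hij
    induction hij with
    | refl => exact List.prefix_rfl
    | step _ ih => exact ih.trans (hpre _)
  let u : ℕ → A := fun n => (Z (n + 1))[n]'(hlen (n + 1))
  have hu : ∀ n, pre u n = (Z n).take n := by
    intro n
    apply List.ext_getElem
    · simp [pre, hlen n]
    · intro i h1 h2
      have hi : i < n := by simpa [pre] using h1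
      simp only [pre, List.getElem_ofFn, List.getElem_take, u]
      exact (hmono (i + 1) n hi).getElem _
  apply Subtype.ext
  apply hstab u k.1 k.2
  intro n
  rw [hu]
  have h1 := hfix n
  have h2 := sec_spec M hinv ((Z n).take n) ((Z n).drop n) k
  rw [List.take_append_drop, h1] at h2
  have h3 := congrArg (List.take n) h2
  rw [List.take_append_of_le_length (by rw [g_length M hinv]; simp [hlen n])] at h3
  have h4 : List.take n (k.1 (List.take n (Z n))) = k.1 (List.take n (Z n)) :=
    List.take_of_length_le (by rw [g_length M hinv]; simp)
  rw [h4] at h3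
  exact h3.symm

/-- The helix map. -/
noncomputable def helix (x : M.autGroup × List A) : M.autGroup × List A :=
  (sec M hinv x.2 x.1, x.1.1 x.2)

/-- The helix orbit. -/
noncomputable def hx (x : M.autGroup × List A) (i : ℕ) : M.autGroup × List A :=
  (helix M hinv)^[i] x

theorem hx_succ (x : M.autGroup × List A) (i : ℕ) :
    hx M hinv x (i + 1) = helix M hinv (hx M hinv x i) := Function.iterate_succ_apply' _ _ _

/-- Partial products along the helix. -/
noncomputable def cc (x : M.autGroup × List A) : ℕ → M.autGroup
  | 0 => 1
  | i + 1 => (hx M hinv x i).1 * cc x i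

/-- Concatenation of the words along the helix. -/
noncomputable def ZZ (x : M.autGroup × List A) : ℕ → ℕ → List A
  | _, 0 => []
  | i, j + 1 => (hx M hinv x i).2 ++ ZZ x (i + 1) j

theorem hx_apply_ZZ (x : M.autGroup × List A) (j : ℕ) : ∀ i,
    (hx M hinv x i).1.1 (ZZ M hinv x i j) = ZZ M hinv x (i + 1) j := by
  induction j with
  | zero => intro i; exact List.eq_nil_of_length_eq_zero (by rw [g_length M hinv]; rfl)
  | succ j ih =>
    intro i
    simp only [ZZ]
    rw [sec_spec M hinv, ← ih (i + 1)]
    rw [hx_succ]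
    rfl

theorem cc_apply_ZZ (x : M.autGroup × List A) (i j : ℕ) :
    (cc M hinv x i).1 (ZZ M hinv x 0 j) = ZZ M hinv x i j := by
  induction i with
  | zero => rfl
  | succ i ih =>
    simp only [cc, Subgroup.coe_mul, Equiv.Perm.mul_apply]
    rw [ih, hx_apply_ZZ]

theorem cc_apply (x : M.autGroup × List A) (i : ℕ) :
    (cc M hinv x i).1 x.2 = (hx M hinv x i).2 := by
  have := cc_apply_ZZ M hinv x i 1
  simpa [ZZ, hx] using this

theorem cc_succ' (x : M.autGroup × List A) (i : ℕ) :
    cc M hinv x (i + 1) = sec M hinv x.2 (cc M hinv x i) * x.1 := by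
  induction i with
  | zero => simp [cc, sec_one, hx]
  | succ i ih =>
    have h1 : cc M hinv x (i + 1) = (hx M hinv x i).1 * cc M hinv x i := rfl
    have h2 : cc M hinv x (i + 1 + 1) = (hx M hinv x (i + 1)).1 * cc M hinv x (i + 1) := rfl
    rw [h2]
    conv_rhs => rw [h1, sec_mul, cc_apply, mul_assoc, ← ih]
    rw [hx_succ]
    rfl

/-- Elements represented by words of length `n`. -/
def BB (n : ℕ) : Set M.autGroup := {g | ∃ w : List Q, w.length = n ∧ ev M hinv w = g}

theorem BB_finite [Finite Q] (n : ℕ) : (BB M hinv n).Finite :=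
  ((List.finite_length_eq Q n).image (ev M hinv)).subset (by
    rintro g ⟨w, hw, rfl⟩
    exact ⟨w, hw, rfl⟩)

theorem sec_BB (n : ℕ) (v : List A) (g : M.autGroup) (hg : g ∈ BB M hinv n) :
    sec M hinv v g ∈ BB M hinv n := by
  obtain ⟨w, hw, rfl⟩ := hg
  exact ⟨M.wstep w v, by rw [wstep_length, hw], (sec_ev M hinv v w).symm⟩

theorem hx_mem (x : M.autGroup × List A) (n : ℕ) (hx0 : x.1 ∈ BB M hinv n) (i : ℕ) :
    (hx M hinv x i).1 ∈ BB M hinv n ∧ (hx M hinv x i).2.length = x.2.length := by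
  induction i with
  | zero => exact ⟨hx0, rfl⟩
  | succ i ih =>
    rw [hx_succ]
    exact ⟨sec_BB M hinv n _ _ ih.1, by rw [← ih.2]; exact g_length M hinv _ _⟩

theorem helix_repeat [Finite Q] [Finite A] (hstab : M.AllTrivialBoundaryStabilizers)
    (x : M.autGroup × List A) (n : ℕ) (hx0 : x.1 ∈ BB M hinv n) (hne : x.2 ≠ []) :
    ∃ i k : ℕ, cc M hinv x (i + (k + 1)) = cc M hinv x i := by
  have hfin : ((BB M hinv n) ×ˢ {l : List A | l.length = x.2.length}).Finite :=
    (BB_finite M hinv n).prod (List.finite_length_eq A _)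
  obtain ⟨i, j, hij, he⟩ := hfin.exists_lt_map_eq_of_forall_mem
    (f := hx M hinv x) (fun i => Set.mem_prod.2 (hx_mem M hinv x n hx0 i))
  have hshift : ∀ t, hx M hinv x (i + t) = hx M hinv x (j + t) := by
    intro t
    induction t with
    | zero => exact he
    | succ t ih => rw [← add_assoc, ← add_assoc, hx_succ, hx_succ, ih]
  have hZ : ∀ l t, ZZ M hinv x (i + t) l = ZZ M hinv x (j + t) l := by
    intro l
    induction l with
    | zero => intro t; rfl
    | succ l ih => intro t; simp only [ZZ]; rw [hshift, add_assoc, ih, add_assoc]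
  refine ⟨i, j - i - 1, ?_⟩
  rw [show i + (j - i - 1 + 1) = j by omega]
  have : (cc M hinv x j)⁻¹ * cc M hinv x i = 1 := by
    apply eq_one_of_chain M hinv hstab _ (ZZ M hinv x 0)
    · intro l
      have : ∀ l s, ZZ M hinv x s l <+: ZZ M hinv x s (l + 1) := by
        intro l
        induction l with
        | zero => intro s; exact List.nil_prefix
        | succ l ih =>
          intro s
          rw [ZZ, ZZ]
          exact (List.prefix_append_right_inj _).2 (ih _)
      exact this l 0
    · intro l
      have : ∀ l s, l ≤ (ZZ M hinv x s l).length := by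
        intro l
        induction l with
        | zero => intro s; exact Nat.zero_le _
        | succ l ih =>
          intro s
          rw [ZZ, List.length_append, (hx_mem M hinv x n hx0 s).2]
          have := ih (s + 1)
          have := List.length_pos_iff.2 hne
          omega
      exact this l 0
    · intro l
      simp only [Subgroup.coe_mul, Equiv.Perm.mul_apply]
      rw [cc_apply_ZZ]
      have := hZ l 0
      simp only [add_zero] at this
      rw [this, ← cc_apply_ZZ]
      simp
  rw [inv_mul_eq_one] at this
  exact this

/-! ### Positive words represent everything -/

theorem gen_inv [Finite Q] [Finite A] [Nonempty A] (hrev : M.IsReversible)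
    (hstab : M.AllTrivialBoundaryStabilizers) (q : Q) :
    ∃ w, ev M hinv w = (gen M hinv q)⁻¹ := by
  obtain ⟨a⟩ := ‹Nonempty A›
  let x : M.autGroup × List A := (gen M hinv q, [a])
  obtain ⟨i, k, hik⟩ := helix_repeat M hinv hstab x 1 ⟨[q], rfl, by simp [ev, x]⟩ (by simp [x])
  have hst : ∀ i, ∃ z, (hx M hinv x i).1 = gen M hinv (M.run q z) := by
    intro i
    induction i with
    | zero => exact ⟨[], rfl⟩
    | succ i ih =>
      obtain ⟨z, hz⟩ := ih
      refine ⟨z ++ (hx M hinv x i).2, ?_⟩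
      rw [hx_succ]
      simp only [helix]
      rw [hz, sec_gen]
      simp [run]
  obtain ⟨z, hz⟩ := hst i
  have hl : ∀ k, ∃ l, cc M hinv x (i + (k + 1)) = ev M hinv (l ++ [M.run q z]) * cc M hinv x i := by
    intro k
    induction k with
    | zero => exact ⟨[], by rw [← add_assoc, add_zero, cc, hz]; simp [ev]⟩
    | succ k ih =>
      obtain ⟨l, hl⟩ := ih
      obtain ⟨z', hz'⟩ := hst (i + (k + 1))
      refine ⟨M.run q z' :: l, ?_⟩
      rw [← add_assoc, cc, hz', hl, List.cons_append, ev_cons, mul_assoc]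
  obtain ⟨l, hl⟩ := hl k
  rw [hik] at hl
  have h1 : ev M hinv (l ++ [M.run q z]) = 1 := by
    simpa using hl.symm
  obtain ⟨e, he⟩ := wstep_periodic M hrev z (l ++ [M.run q z])
  set y' := (fun w => M.wstep w z)^[e] (l ++ [M.run q z]) with hy'
  have hev : ev M hinv y' = 1 := by
    rw [hy', ← sec_ev_iterate, h1, sec_iterate_one]
  rw [Function.iterate_succ_apply', ← hy'] at he
  rcases List.eq_nil_or_concat y' with h | ⟨y0, p, hp⟩
  · rw [h] at he
    simp [wstep] at he
  · rw [hp] at he hev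
    obtain ⟨w', hw'⟩ := wstep_concat M y0 p z
    simp only [List.concat_eq_append] at he hev
    rw [hw'] at he
    have h2 := (List.append_inj' he rfl).2
    simp only [List.cons.injEq, and_true] at h2
    obtain rfl : p = q := run_inj M hrev z h2
    refine ⟨y0, ?_⟩
    rw [ev_append] at hev
    rw [eq_inv_iff_mul_eq_one, ← hev]
    simp [ev]

theorem ev_surj [Finite Q] [Finite A] [Nonempty A] (hrev : M.IsReversible)
    (hstab : M.AllTrivialBoundaryStabilizers) (g : M.autGroup) :
    ∃ w, ev M hinv w = g := by
  have hinvw : ∀ w, ∃ w', ev M hinv w' = (ev M hinv w)⁻¹ := by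
    intro w
    induction w with
    | nil => exact ⟨[], by simp [ev]⟩
    | cons q w ih =>
      obtain ⟨w', hw'⟩ := ih
      obtain ⟨l, hl⟩ := gen_inv M hinv hrev hstab q
      exact ⟨w' ++ l, by rw [ev_append, hw', hl, ev_cons, mul_inv_rev]⟩
  obtain ⟨g, hg⟩ := g
  suffices h : ∃ w, (ev M hinv w).1 = g by
    obtain ⟨w, hw⟩ := h
    exact ⟨w, Subtype.ext hw⟩
  induction hg using Subgroup.closure_induction with
  | mem σ hσ =>
    obtain ⟨q, hq⟩ := hσ
    refine ⟨[q], ?_⟩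
    ext1 w
    rw [ev_apply, hq]; rfl
  | one => exact ⟨[], rfl⟩
  | mul g h _ _ ihg ihh =>
    obtain ⟨v, rfl⟩ := ihg
    obtain ⟨w, rfl⟩ := ihh
    exact ⟨v ++ w, by rw [ev_append]; rfl⟩
  | inv g _ ih =>
    obtain ⟨v, rfl⟩ := ih
    obtain ⟨w, hw⟩ := hinvw v
    exact ⟨w, by rw [hw]; rfl⟩

theorem sec_injective [Finite Q] [Finite A] [Nonempty A] (hrev : M.IsReversible)
    (hstab : M.AllTrivialBoundaryStabilizers) (v : List A) :
    Function.Injective (sec M hinv v) := by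
  intro g h hgh
  obtain ⟨k, rfl⟩ : ∃ k, h = k * g := ⟨h * g⁻¹, by simp⟩
  rw [sec_mul] at hgh
  have h1 : sec M hinv (g.1 v) k = 1 := by simpa using hgh.symm
  obtain ⟨w, rfl⟩ := ev_surj M hinv hrev hstab k
  rw [ev_eq_one_of_sec M hinv hrev _ w h1, one_mul]

theorem sec_periodic [Finite Q] (hrev : M.IsReversible) (v : List A) (w : List Q) :
    ∃ e : ℕ, (sec M hinv v)^[e + 1] (ev M hinv w) = ev M hinv w := by
  obtain ⟨e, he⟩ := wstep_periodic M hrev v w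
  exact ⟨e, by rw [sec_ev_iterate, he]⟩

theorem sec_BB_surj [Finite Q] (hrev : M.IsReversible) (v : List A) (n : ℕ) (h : M.autGroup)
    (hh : h ∈ BB M hinv n) : ∃ g ∈ BB M hinv n, sec M hinv v g = h := by
  obtain ⟨w, hw, rfl⟩ := hh
  obtain ⟨e, he⟩ := sec_periodic M hinv hrev v w
  rw [Function.iterate_succ_apply'] at he
  refine ⟨_, ?_, he⟩
  clear he
  induction e with
  | zero => exact ⟨w, hw, rfl⟩
  | succ e ih => rw [Function.iterate_succ_apply']; exact sec_BB M hinv n v _ ih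

theorem sec_BB_iff [Finite Q] [Finite A] [Nonempty A] (hrev : M.IsReversible)
    (hstab : M.AllTrivialBoundaryStabilizers) (v : List A) (n : ℕ) (g : M.autGroup) :
    sec M hinv v g ∈ BB M hinv n ↔ g ∈ BB M hinv n := by
  refine ⟨fun h => ?_, sec_BB M hinv n v g⟩
  obtain ⟨g', hg', he⟩ := sec_BB_surj M hinv hrev v n _ h
  rwa [← sec_injective M hinv hrev hstab v he]

theorem sec_bijective [Finite Q] [Finite A] [Nonempty A] (hrev : M.IsReversible)
    (hstab : M.AllTrivialBoundaryStabilizers) (v : List A) :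
    Function.Bijective (sec M hinv v) := by
  refine ⟨sec_injective M hinv hrev hstab v, fun h => ?_⟩
  obtain ⟨w, rfl⟩ := ev_surj M hinv hrev hstab h
  obtain ⟨g, -, hg⟩ := sec_BB_surj M hinv hrev v _ _ ⟨w, rfl, rfl⟩
  exact ⟨g, hg⟩

theorem sec_replicate (a : A) (e : ℕ) (g : M.autGroup) :
    sec M hinv (List.replicate e a) g = (sec M hinv [a])^[e] g := by
  induction e generalizing g with
  | zero => exact sec_nil M hinv g
  | succ e ih =>
    rw [Function.iterate_succ_apply, ← ih, ← sec_append]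
    rfl

/-- The group of permutations of `G` preserving the word metric structure. -/
def KK : Subgroup (Equiv.Perm M.autGroup) where
  carrier := {f | ∀ n g h, f h * (f g)⁻¹ ∈ BB M hinv n ↔ h * g⁻¹ ∈ BB M hinv n}
  one_mem' := fun _ _ _ => Iff.rfl
  mul_mem' := fun {f f'} hf hf' n g h => (hf n (f' g) (f' h)).trans (hf' n g h)
  inv_mem' := fun {f} hf n g h => by
    have := hf n (f⁻¹ g) (f⁻¹ h)
    simpa using this.symm

theorem torsion (hinv : M.IsInvertible) [Finite Q] [Finite A] [Nonempty A] (hrev : M.IsReversible)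
    (hstab : M.AllTrivialBoundaryStabilizers) (g : M.autGroup) :
    ∃ n : ℕ, 0 < n ∧ g ^ n = 1 := by
  let t : Equiv.Perm M.autGroup := Equiv.mulRight g
  let P : List A → Equiv.Perm M.autGroup := fun v =>
    Equiv.ofBijective _ (sec_bijective M hinv hrev hstab v)
  have hP : ∀ v h, P v h = sec M hinv v h := fun _ _ => rfl
  have ht1 : ∀ x, t x = x * g := fun _ => rfl
  have ht : t ∈ KK M hinv := by
    intro n x y
    simp [ht1, mul_assoc]
  have hPK : ∀ v, P v ∈ KK M hinv := by
    intro v n x y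
    obtain ⟨k, rfl⟩ : ∃ k, y = k * x := ⟨y * x⁻¹, by simp⟩
    rw [hP, hP, sec_mul, mul_inv_cancel_right, mul_inv_cancel_right]
    exact sec_BB_iff M hinv hrev hstab _ n k
  have htpow : ∀ j : ℕ, (t ^ j) 1 = g ^ j := by
    intro j
    induction j with
    | zero => rfl
    | succ j ih => rw [pow_succ', Equiv.Perm.mul_apply, ih, ht1, pow_succ]
  obtain ⟨N, hN⟩ := tidy_aux (KK M hinv) t ht 1 (by
    intro y
    obtain ⟨w, hw⟩ := ev_surj M hinv hrev hstab y
    refine (BB_finite M hinv w.length).subset ?_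
    rintro z ⟨f, hf, hf1, rfl⟩
    have := (hf w.length 1 y).2 (by simpa using ⟨w, rfl, hw⟩)
    simpa [hf1] using this)
  obtain ⟨a⟩ := ‹Nonempty A›
  have hwin : ∀ n : ℕ, ∃ e : ℕ, ∀ i ≤ n,
      Function.IsPeriodicPt (sec M hinv [a]) (e + 1) (g ^ i) := by
    intro n
    have hone : ∀ i : ℕ, ∃ e : ℕ, Function.IsPeriodicPt (sec M hinv [a]) (e + 1) (g ^ i) := by
      intro i
      obtain ⟨w, hw⟩ := ev_surj M hinv hrev hstab (g ^ i)
      rw [← hw]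
      exact sec_periodic M hinv hrev [a] w
    induction n with
    | zero =>
      obtain ⟨e, he⟩ := hone 0
      exact ⟨e, fun i hi => by obtain rfl : i = 0 := by omega
                               exact he⟩
    | succ n ih =>
      obtain ⟨e, he⟩ := ih
      obtain ⟨e', he'⟩ := hone (n + 1)
      refine ⟨(e + 1) * (e' + 1) - 1, fun i hi => ?_⟩
      rw [Nat.sub_add_cancel (Nat.mul_pos (Nat.succ_pos _) (Nat.succ_pos _))]
      rcases Nat.lt_or_ge n i with h | h
      · obtain rfl : i = n + 1 := by omega
        exact he'.const_mul _
      · exact (he i h).mul_const _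
  obtain ⟨e, he⟩ := hwin N
  let v := List.replicate (e + 1) a
  have hkey := hN (P v) (hPK v) (by
    intro i hi
    rw [htpow, hP, sec_replicate]
    exact he i hi)
  obtain ⟨w, hw⟩ := ev_surj M hinv hrev hstab g
  obtain ⟨i, k, hik⟩ := helix_repeat M hinv hstab (g, v) w.length ⟨w, rfl, hw⟩ (by simp [v])
  have hcc : ∀ j, ((t * P v) ^ j) 1 = cc M hinv (g, v) j := by
    intro j
    induction j with
    | zero => rfl
    | succ j ih => rw [pow_succ', Equiv.Perm.mul_apply, ih, cc_succ']; rfl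
  rw [← hcc, ← hcc, pow_add, Equiv.Perm.mul_apply] at hik
  have h1 := hkey (k + 1) (((t * P v) ^ i).injective hik)
  rw [htpow] at h1
  exact ⟨k + 1, Nat.succ_pos _, h1⟩

end

end MealyAux

/-- If `A` is a reversible invertible Mealy automaton whose group `G = 𝒢(A)` is
infinite and all boundary stabilizers are trivial, then `G` is a Burnside group:
every element has finite order. -/
theorem autGroup_burnside_of_trivial_boundary_stabilizers {Q A : Type}
    [Fintype Q] [Fintype A] (M : Mealy Q A)
    (hrev : M.IsReversible) (hinv : M.IsInvertible)
    (hInf : Infinite M.autGroup)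
    (hstab : M.AllTrivialBoundaryStabilizers) :
    ∀ g ∈ M.autGroup, ∃ n : ℕ, 0 < n ∧ g ^ n = 1 := by
  intro g hg
  rcases isEmpty_or_nonempty A with hA | hA
  · exact absurd hInf (not_infinite_iff_finite.2 inferInstance)
  · obtain ⟨n, hn, h⟩ := MealyAux.torsion M hinv hrev hstab ⟨g, hg⟩
    exact ⟨n, hn, congrArg Subtype.val h⟩
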